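/- Let Ω ⊂ ℝ² be a bounded, open, simply connected set and ψ : ∂Ω → ℝ continuous. Let fₐ : [0,∞) → ℝ be strictly convex, continuously differentiable on [0,∞), twice continuously differentiable on (0,∞), with f'ₐ(0) = 0 and f'ₐ a strictly increasing bijection of [0,∞) onto [0,∞); denote by g'ₐ the inverse function of f'ₐ, and assume that lim_{ρ→0⁺} ρ f''ₐ(ρ)/f'ₐ(ρ) exists and is a positive constant; set αₐ(ρ) = ρ f''ₐ(ρ)/f'ₐ(ρ) for ρ > 0 and αₐ(0) equal to that limit. Let uₐ be a Lipschitz minimizer of Jₐ(w) = ∫_Ω fₐ(‖∇w‖) dx with boundary values ψ, and let vₐ be the unique zero-mean Lipschitz stream function of uₐ, i.e. ∫_Ω vₐ = 0 and a.e. ∂ₓvₐ = −f'ₐ(‖∇uₐ‖)∂ᵧuₐ/‖∇uₐ‖, ∂ᵧvₐ = f'ₐ(‖∇uₐ‖)∂ₓuₐ/‖∇uₐ‖ (right-hand sides taken as 0 where ∇uₐ = 0). Then vₐ is a viscosity solution in Ω of −[1 − αₐ(g'ₐ(‖∇v‖))]·Δ∞v − ‖∇v‖²·αₐ(g'ₐ(‖∇v‖))·Δv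 = 0. -/

import Mathlib

open Set MeasureTheory Metric Filter
open scoped RealInnerProductSpace Topology Classical

noncomputable section

abbrev E2 := EuclideanSpace ℝ (Fin 2)

/-- A function is Lipschitz on a set (with some constant). -/
def LipOn (w : E2 → ℝ) (s : Set E2) : Prop := ∃ L : NNReal, LipschitzOnWith L w s

/-- The functional `J(w) = ∫_Ω f(‖∇w‖)`, with `∇w` the a.e.-defined (Rademacher) gradient,
extended by the junk value `0` where `w` is not differentiable. -/
def J (f : ℝ → ℝ) (Ω : Set E2) (w : E2 → ℝ) : ℝ := ∫ x in Ω, f ‖gradient w x‖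

/-- The (one-sided at `0`) derivative of `f` on `[0,∞)`. -/
def dtop (f : ℝ → ℝ) : ℝ → ℝ := derivWithin f (Set.Ici 0)

/-- Standing assumptions on the Lagrangian `f` : strictly convex on `[0,∞)`, `C¹` on `[0,∞)`,
`C²` on `(0,∞)` with `f''` locally Hölder continuous of some exponent `λ ∈ (0,1)`,
and `f'(0) > 0`. -/
def StdF (f : ℝ → ℝ) : Prop :=
  StrictConvexOn ℝ (Set.Ici 0) f ∧ ContDiffOn ℝ 1 f (Set.Ici 0) ∧
  ContDiffOn ℝ 2 f (Set.Ioi 0) ∧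
  (∃ lam : NNReal, 0 < lam ∧ lam < 1 ∧ ∀ K : Set ℝ, IsCompact K → K ⊆ Set.Ioi 0 →
    ∃ C : NNReal, HolderOnWith C lam (deriv (dtop f)) K) ∧
  0 < dtop f 0

/-- `u` solves the variational problem (P): `u` is Lipschitz on the closure of `Ω`,
`u = ψ` on `∂Ω`, and `u` minimizes `J` among such functions. -/
def SolvesP (f : ℝ → ℝ) (Ω : Set E2) (ψ : E2 → ℝ) (u : E2 → ℝ) : Prop :=
  LipOn u (closure Ω) ∧ EqOn u ψ (frontier Ω) ∧
  ∀ w : E2 → ℝ, LipOn w (closure Ω) → EqOn w ψ (frontier Ω) → J f Ω u ≤ J f Ω w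

/-- `u` has an isolated critical point in `Ω`. -/
def HasIsolatedCritPt (Ω : Set E2) (u : E2 → ℝ) : Prop :=
  ∃ z₀ ∈ Ω, ∃ r > (0:ℝ), gradient u z₀ = 0 ∧
    ∀ z ∈ Ω, z ≠ z₀ → dist z z₀ < r → gradient u z ≠ 0

/-- `v` is a zero-mean stream function for `u` on `Ω` (relative to the Lagrangian derivative
`f'`): `v` is Lipschitz on `Ω`, has zero mean on `Ω`, and satisfies almost everywhere in `Ω`
`∂ₓv = −f'(‖∇u‖)∂ᵧu/‖∇u‖`, `∂ᵧv = f'(‖∇u‖)∂ₓu/‖∇u‖` (right-hand sides taken to be `0`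
where `∇u = 0`). -/
def IsStreamFn (f' : ℝ → ℝ) (Ω : Set E2) (u v : E2 → ℝ) : Prop :=
  LipOn v Ω ∧ (∫ z in Ω, v z) = 0 ∧
  ∀ᵐ z ∂(volume.restrict Ω),
    gradient v z 0 = (if gradient u z = 0 then 0
      else -(f' ‖gradient u z‖ * gradient u z 1 / ‖gradient u z‖)) ∧
    gradient v z 1 = (if gradient u z = 0 then 0
      else f' ‖gradient u z‖ * gradient u z 0 / ‖gradient u z‖)

/-- `w` is a viscosity solution of `F(∇w, ∇²w) = 0` in `Ω ⊆ ℝ²`. -/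
def ViscositySol (Ω : Set E2) (F : E2 → (E2 →L[ℝ] E2) → ℝ) (w : E2 → ℝ) : Prop :=
  ContinuousOn w Ω ∧
  (∀ x ∈ Ω, ∀ φ : E2 → ℝ, ContDiff ℝ 2 φ →
    IsLocalMaxOn (fun y => w y - φ y) Ω x →
    F (gradient φ x) (fderiv ℝ (gradient φ) x) ≤ 0) ∧
  (∀ x ∈ Ω, ∀ φ : E2 → ℝ, ContDiff ℝ 2 φ →
    IsLocalMinOn (fun y => w y - φ y) Ω x →
    0 ≤ F (gradient φ x) (fderiv ℝ (gradient φ) x))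

theorem lineDeriv_eq_zero_of_notMem_tsupport {η : E2 → ℝ} {x : E2} (h : x ∉ tsupport η) (v : E2) :
    lineDeriv ℝ η x v = 0 := by
  have : η =ᶠ[𝓝 x] fun _ => 0 := notMem_tsupport_iff_eventuallyEq.mp h
  rw [this.lineDeriv_eq]
  simp [lineDeriv]

theorem integrable_mul_lineDeriv {D : NNReal} {η g : E2 → ℝ}
    (hη : LipschitzWith D η) (hc : HasCompactSupport η) (v : E2)
    (hg : AEStronglyMeasurable g) (C : ℝ) (hgC : ∀ x ∈ tsupport η, |g x| ≤ C) :
    Integrable (fun x => g x * lineDeriv ℝ η x v) := by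
  have hi : Integrable ((tsupport η).indicator (fun _ => C * (D * ‖v‖))) := by
    rw [integrable_indicator_iff hc.isCompact.measurableSet]
    exact integrableOn_const hc.isCompact.measure_lt_top.ne
  refine hi.mono' (hg.mul (aestronglyMeasurable_lineDeriv hη.continuous _)) ?_
  filter_upwards with x
  by_cases hx : x ∈ tsupport η
  · rw [indicator_of_mem hx, norm_mul]
    exact mul_le_mul (hgC x hx) (norm_lineDeriv_le_of_lipschitz ℝ hη) (norm_nonneg _)
      ((abs_nonneg _).trans (hgC x hx))
  · rw [indicator_of_notMem hx, lineDeriv_eq_zero_of_notMem_tsupport hx]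
    simp

/-- Weak form of the symmetry of second derivatives for Lipschitz functions. -/
theorem integral_lineDeriv_mul_lineDeriv_comm {C D : NNReal} {U η : E2 → ℝ}
    (hU : LipschitzWith C U) (hη : LipschitzWith D η) (hc : HasCompactSupport η) (a b : E2) :
    ∫ x, lineDeriv ℝ U x a * lineDeriv ℝ η x b = ∫ x, lineDeriv ℝ U x b * lineDeriv ℝ η x a := by
  have hd : ∀ v : E2, Integrable (fun x => lineDeriv ℝ η x v) := by
    intro v
    simpa using integrable_mul_lineDeriv hη hc v (g := fun _ => 1) aestronglyMeasurable_const 1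
      (by simp)
  let K := cthickening ‖b‖ (tsupport η)
  have hK : IsCompact K := hc.isCompact.cthickening
  have hηK : ∀ x ∉ K, η x = 0 := by
    intro x hx
    by_contra h
    exact hx (self_subset_cthickening _ (subset_tsupport _ h))
  have hηK' : ∀ t : ℝ, 0 < t → t ≤ 1 → ∀ x ∉ K, η (x + t • b) = 0 := by
    intro t ht ht1 x hx
    by_contra h
    apply hx
    apply mem_cthickening_of_dist_le _ _ _ (tsupport η) (subset_tsupport _ h)
    simp only [dist_eq_norm, sub_add_cancel_left, norm_neg, norm_smul, Real.norm_eq_abs,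
      abs_of_nonneg ht.le]
    exact mul_le_of_le_one_left (norm_nonneg _) ht1
  have hUa : Integrable (K.indicator (fun x => lineDeriv ℝ U x a)) := by
    rw [integrable_indicator_iff hK.measurableSet]
    exact (hU.locallyIntegrable_lineDeriv a).integrableOn_isCompact hK
  have A := hη.integral_inv_smul_sub_mul_tendsto_integral_lineDeriv_mul hUa b
  have B := hU.integral_inv_smul_sub_mul_tendsto_integral_lineDeriv_mul (hd (-a)) (-b)
  have S : ∀ t : ℝ, 0 < t → t ≤ 1 →
      ∫ x, (t⁻¹ • (η (x + t • b) - η x)) * K.indicator (fun x => lineDeriv ℝ U x a) x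
        = ∫ x, (t⁻¹ • (U (x + t • (-b)) - U x)) * lineDeriv ℝ η x (-a) := by
    intro t ht ht1
    have e1 : ∀ x, (t⁻¹ • (η (x + t • b) - η x)) * K.indicator (fun x => lineDeriv ℝ U x a) x
        = lineDeriv ℝ U x a * (t⁻¹ • (η (x + t • b) - η x)) := by
      intro x
      by_cases hx : x ∈ K
      · rw [indicator_of_mem hx, mul_comm]
      · rw [hηK x hx, hηK' t ht ht1 x hx]; simp
    simp_rw [e1]
    have hsh : LipschitzWith D (fun x => η (x + t • b)) := by
      have := hη.comp (isometry_add_right (t • b)).lipschitz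
      simpa [Function.comp_def] using this
    have hsc : HasCompactSupport (fun x => η (x + t • b)) :=
      hc.comp_homeomorph (Homeomorph.addRight (t • b))
    have hL : LipschitzWith (‖t⁻¹‖₊ * (D + D)) (fun x => t⁻¹ • (η (x + t • b) - η x)) := by
      have h2 := hsh.sub hη
      have h1 : LipschitzWith ‖t⁻¹‖₊ (fun r : ℝ => t⁻¹ • r) := lipschitzWith_smul t⁻¹
      exact h1.comp h2
    have hLc : HasCompactSupport (fun x => t⁻¹ • (η (x + t • b) - η x)) := by
      have h2 : HasCompactSupport (fun x => η (x + t • b) - η x) := hsc.sub hc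
      exact h2.smul_left (f := fun _ => t⁻¹)
    rw [hU.integral_lineDeriv_mul_eq hL hLc a]
    have e2 : (fun x => lineDeriv ℝ (fun x => t⁻¹ • (η (x + t • b) - η x)) x (-a) * U x) =ᵐ[volume]
        fun x => t⁻¹ * (lineDeriv ℝ η (x + t • b) (-a) * U x) - t⁻¹ * (lineDeriv ℝ η x (-a) * U x) := by
      have h1 := hη.ae_differentiableAt (μ := (volume : Measure E2))
      have h2 : ∀ᵐ x : E2, DifferentiableAt ℝ η (x + t • b) :=
        (measurePreserving_add_right volume (t • b)).quasiMeasurePreserving.ae h1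
      filter_upwards [h1, h2] with x hx1 hx2
      have hx2' := (hx2.lineDifferentiableAt (v := -a)).hasLineDerivAt
      have hx1' := (hx1.lineDifferentiableAt (v := -a)).hasLineDerivAt
      have : HasLineDerivAt ℝ (fun x => t⁻¹ • (η (x + t • b) - η x))
          (t⁻¹ • (lineDeriv ℝ η (x + t • b) (-a) - lineDeriv ℝ η x (-a))) x (-a) := by
        unfold HasLineDerivAt at *
        have := (hx2'.sub hx1').const_smul t⁻¹
        refine this.congr_of_eventuallyEq (Eventually.of_forall fun τ => ?_)
        simp [add_right_comm]
      rw [this.lineDeriv, smul_eq_mul]; ring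
    rw [integral_congr_ae e2]
    have i1 : Integrable (fun x => lineDeriv ℝ η x (-a) * U x) := by
      obtain ⟨M, hM⟩ := (hc.isCompact.image hU.continuous).isBounded.exists_norm_le
      simpa only [mul_comm] using integrable_mul_lineDeriv hη hc (-a)
        hU.continuous.aestronglyMeasurable M (fun x hx => hM _ (mem_image_of_mem _ hx))
    have i2 : Integrable (fun x => lineDeriv ℝ η x (-a) * U (x + t • (-b))) := by
      have hU' : Continuous (fun x => U (x + t • (-b))) := hU.continuous.comp (by fun_prop)
      obtain ⟨M, hM⟩ := (hc.isCompact.image hU').isBounded.exists_norm_le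
      simpa only [mul_comm] using integrable_mul_lineDeriv hη hc (-a)
        hU'.aestronglyMeasurable M (fun x hx => hM _ (mem_image_of_mem _ hx))
    have e3 : ∀ x, lineDeriv ℝ η x (-a) * U (x + t • (-b)) =
        (fun x => lineDeriv ℝ η (x + t • b) (-a) * U x) (x + t • (-b)) := by
      intro x; simp
    have i3 : Integrable (fun x => lineDeriv ℝ η (x + t • b) (-a) * U x) := by
      have := i2.comp_add_right (t • b)
      simpa using this
    rw [integral_sub (i3.const_mul _) (i1.const_mul _), integral_const_mul, integral_const_mul,
      ← integral_add_right_eq_self _ (t • (-b))]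
    simp_rw [← e3]
    rw [← mul_sub, ← integral_sub i2 i1, ← integral_const_mul]
    congr 1; ext x; rw [smul_eq_mul]; ring
  have h := tendsto_nhds_unique (A.congr' ?_) B
  · have e : ∀ x, lineDeriv ℝ η x b * K.indicator (fun x => lineDeriv ℝ U x a) x
        = lineDeriv ℝ U x a * lineDeriv ℝ η x b := by
      intro x
      by_cases hx : x ∈ K
      · rw [indicator_of_mem hx, mul_comm]
      · rw [lineDeriv_eq_zero_of_notMem_tsupport
          (fun h => hx (self_subset_cthickening _ h)), zero_mul, mul_zero]
    simp_rw [e] at h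
    simpa [lineDeriv_neg] using h
  · filter_upwards [Ioc_mem_nhdsGT zero_lt_one] with t ht using S t ht.1 ht.2

/-- `ρ ↦ (h ρ / ρ) p` with `ρ = ‖p‖` is a monotone vector field for nondecreasing `h ≥ 0`. -/
theorem monotone_radial_field {h : ℝ → ℝ} (hm : MonotoneOn h (Ici 0)) (h0 : ∀ s, 0 ≤ s → 0 ≤ h s)
    (p q : E2) : 0 ≤ ⟪(h ‖p‖ / ‖p‖) • p - (h ‖q‖ / ‖q‖) • q, p - q⟫ := by
  have hp := norm_nonneg p
  have hq := norm_nonneg q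
  have key : ∀ r : E2, h ‖r‖ / ‖r‖ * (‖r‖ * ‖r‖) = h ‖r‖ * ‖r‖ := by
    intro r
    rcases eq_or_ne ‖r‖ 0 with h | h
    · simp [h]
    · field_simp
  have key' : ∀ r : E2, ∀ t : ℝ, 0 ≤ t → h ‖r‖ / ‖r‖ * (‖r‖ * t) ≤ h ‖r‖ * t := by
    intro r t ht
    rcases eq_or_ne ‖r‖ 0 with hr | hr
    · rw [hr]; simp; exact mul_nonneg (h0 0 le_rfl) ht
    · apply le_of_eq; field_simp
  simp only [inner_sub_left, inner_sub_right, real_inner_smul_left, real_inner_self_eq_norm_mul_norm,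
    key, real_inner_comm p q]
  have hpq : ⟪p, q⟫ ≤ ‖p‖ * ‖q‖ := real_inner_le_norm p q
  have h1 : h ‖p‖ / ‖p‖ * ⟪p, q⟫ ≤ h ‖p‖ * ‖q‖ :=
    (mul_le_mul_of_nonneg_left hpq (div_nonneg (h0 _ hp) hp)).trans (key' p _ hq)
  have h2 : h ‖q‖ / ‖q‖ * ⟪p, q⟫ ≤ h ‖q‖ * ‖p‖ := by
    refine (mul_le_mul_of_nonneg_left hpq (div_nonneg (h0 _ hq) hq)).trans ?_
    rw [mul_comm ‖p‖]; exact key' q _ hp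
  have h3 : 0 ≤ (h ‖p‖ - h ‖q‖) * (‖p‖ - ‖q‖) := by
    rcases le_total ‖p‖ ‖q‖ with hle | hle
    · exact mul_nonneg_of_nonpos_of_nonpos (sub_nonpos.2 (hm hp hq hle)) (sub_nonpos.2 hle)
    · exact mul_nonneg (sub_nonneg.2 (hm hq hp hle)) (sub_nonneg.2 hle)
  nlinarith

theorem nonneg_of_invOn {k h : ℝ → ℝ} (hb : BijOn k (Ici 0) (Ici 0))
    (hinv : InvOn h k (Ici 0) (Ici 0)) {s : ℝ} (hs : 0 ≤ s) : 0 ≤ h s := by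
  obtain ⟨ρ, hρ, rfl⟩ := hb.surjOn hs
  rw [hinv.1 hρ]; exact hρ

theorem strictMonoOn_of_invOn {k h : ℝ → ℝ} (hk : StrictMonoOn k (Ici 0))
    (hb : BijOn k (Ici 0) (Ici 0)) (hinv : InvOn h k (Ici 0) (Ici 0)) :
    StrictMonoOn h (Ici 0) := by
  intro s hs t ht hst
  by_contra! hle
  have := hk.monotoneOn (nonneg_of_invOn hb hinv ht) (nonneg_of_invOn hb hinv hs) hle
  rw [hinv.2 hs, hinv.2 ht] at this
  exact absurd hst this.not_gt

theorem continuousAt_of_invOn {k h : ℝ → ℝ} (hk : StrictMonoOn k (Ici 0))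
    (hb : BijOn k (Ici 0) (Ici 0)) (hinv : InvOn h k (Ici 0) (Ici 0)) {s : ℝ} (hs : 0 < s) :
    ContinuousAt h s := by
  have hm := strictMonoOn_of_invOn hk hb hinv
  refine hm.continuousAt_of_image_mem_nhds (Ici_mem_nhds hs) ?_
  have hpos : 0 < h s :=
    (nonneg_of_invOn hb hinv le_rfl).trans_lt (hm (mem_Ici.2 le_rfl) hs.le hs)
  refine mem_of_superset (Ici_mem_nhds hpos) fun ρ hρ => ⟨k ρ, hb.mapsTo hρ, hinv.1 hρ⟩

theorem pos_of_invOn {k h : ℝ → ℝ} (hk : StrictMonoOn k (Ici 0))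
    (hb : BijOn k (Ici 0) (Ici 0)) (hinv : InvOn h k (Ici 0) (Ici 0)) {s : ℝ} (hs : 0 < s) :
    0 < h s :=
  (nonneg_of_invOn hb hinv le_rfl).trans_lt
    (strictMonoOn_of_invOn hk hb hinv (mem_Ici.2 le_rfl) hs.le hs)

theorem hasDerivAt_of_invOn {k h : ℝ → ℝ} {k' : ℝ} (hk : StrictMonoOn k (Ici 0))
    (hb : BijOn k (Ici 0) (Ici 0)) (hinv : InvOn h k (Ici 0) (Ici 0)) {s : ℝ} (hs : 0 < s)
    (hd : HasDerivAt k k' (h s)) (h0 : k' ≠ 0) : HasDerivAt h k'⁻¹ s :=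
  HasDerivAt.of_local_left_inverse (continuousAt_of_invOn hk hb hinv hs) hd h0
    (mem_of_superset (Ici_mem_nhds hs) fun _ hy => hinv.2 hy)

theorem contDiffOn_of_invOn {k h : ℝ → ℝ} {k' : ℝ → ℝ} (hk : StrictMonoOn k (Ici 0))
    (hb : BijOn k (Ici 0) (Ici 0)) (hinv : InvOn h k (Ici 0) (Ici 0))
    (hd : ∀ ρ, 0 < ρ → HasDerivAt k (k' ρ) ρ) (hc : ContinuousOn k' (Ioi 0))
    (h0 : ∀ ρ, 0 < ρ → k' ρ ≠ 0) : ContDiffOn ℝ 1 h (Ioi 0) := by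
  have hD : ∀ s, 0 < s → HasDerivAt h (k' (h s))⁻¹ s := fun s hs =>
    hasDerivAt_of_invOn hk hb hinv hs (hd _ (pos_of_invOn hk hb hinv hs))
      (h0 _ (pos_of_invOn hk hb hinv hs))
  rw [show (1 : WithTop ℕ∞) = 0 + 1 by simp, contDiffOn_succ_iff_deriv_of_isOpen isOpen_Ioi]
  refine ⟨fun s hs => (hD s hs).differentiableAt.differentiableWithinAt, by simp, ?_⟩
  rw [contDiffOn_zero]
  have : ContinuousOn (fun s => (k' (h s))⁻¹) (Ioi 0) := by
    refine ContinuousOn.inv₀ ?_ fun s hs => h0 _ (pos_of_invOn hk hb hinv hs)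
    exact hc.comp (fun s hs => (continuousAt_of_invOn hk hb hinv hs).continuousWithinAt)
      fun s hs => pos_of_invOn hk hb hinv hs
  exact this.congr fun s hs => (hD s hs).deriv

theorem bijOn_add_mul {k : ℝ → ℝ} (hk : StrictMonoOn k (Ici 0))
    (hb : BijOn k (Ici 0) (Ici 0)) (hc : ContinuousOn k (Ici 0)) (hk0 : k 0 = 0)
    {ε : ℝ} (hε : 0 < ε) :
    StrictMonoOn (fun ρ => k ρ + ε * ρ) (Ici 0) ∧
      BijOn (fun ρ => k ρ + ε * ρ) (Ici 0) (Ici 0) := by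
  have hm : StrictMonoOn (fun ρ => k ρ + ε * ρ) (Ici 0) := fun x hx y hy hxy =>
    add_lt_add (hk hx hy hxy) (mul_lt_mul_of_pos_left hxy hε)
  refine ⟨hm, fun ρ hρ => add_nonneg (hb.mapsTo hρ) (mul_nonneg hε.le hρ), hm.injOn, ?_⟩
  intro s hs
  obtain ⟨M, hM, rfl⟩ := hb.surjOn hs
  have hc' : ContinuousOn (fun ρ => k ρ + ε * ρ) (Icc 0 M) :=
    (hc.mono Icc_subset_Ici_self).add (by fun_prop)
  obtain ⟨ρ, hρ, h⟩ := intermediate_value_Icc hM hc'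
    (show k M ∈ Icc _ _ from ⟨by simpa [hk0] using hs, by
      have := mul_nonneg hε.le hM
      change k M ≤ k M + ε * M
      linarith⟩)
  exact ⟨ρ, hρ.1, h⟩

/-- Integration by parts for a field of class `C¹` near the support of a Lipschitz function. -/
theorem integral_mul_lineDeriv_of_contDiffOn {D : NNReal} {η ζ : E2 → ℝ} {x : E2} {s r : ℝ}
    (hη : LipschitzWith D η) (hsupp : tsupport η ⊆ closedBall x s) (hsr : s < r)
    (hζ : ContDiffOn ℝ 1 ζ (ball x r)) (v : E2) :
    Integrable (fun y => ζ y * lineDeriv ℝ η y v) ∧ Integrable (fun y => lineDeriv ℝ ζ y v * η y) ∧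
      ∫ y, ζ y * lineDeriv ℝ η y v = - ∫ y, lineDeriv ℝ ζ y v * η y := by
  have hc : HasCompactSupport η :=
    (isCompact_closedBall x s).of_isClosed_subset (isClosed_tsupport _) hsupp
  obtain ⟨s', hs, hs'⟩ := exists_between hsr
  obtain ⟨K, hK⟩ := (hζ.mono (closedBall_subset_ball hs')).exists_lipschitzOnWith one_ne_zero
    (convex_closedBall x s') (isCompact_closedBall x s')
  obtain ⟨ζ', hζ', heq⟩ := hK.extend_real
  have hmem : ∀ y ∈ tsupport η, closedBall x s' ∈ 𝓝 y := fun y hy =>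
    mem_of_superset (isOpen_ball.mem_nhds (closedBall_subset_ball hs (hsupp hy)))
      ball_subset_closedBall
  have e1 : (fun y => ζ y * lineDeriv ℝ η y v) = fun y => ζ' y * lineDeriv ℝ η y v := by
    ext y
    by_cases hy : y ∈ tsupport η
    · rw [heq (mem_of_mem_nhds (hmem y hy))]
    · simp [lineDeriv_eq_zero_of_notMem_tsupport hy]
  have e2 : (fun y => lineDeriv ℝ ζ y v * η y) = fun y => lineDeriv ℝ ζ' y v * η y := by
    ext y
    by_cases hy : y ∈ tsupport η
    · rw [(heq.eventuallyEq_of_mem (hmem y hy)).lineDeriv_eq]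
    · simp [image_eq_zero_of_notMem_tsupport hy]
  rw [e1, e2]
  refine ⟨?_, ?_, ?_⟩
  · obtain ⟨M, hM⟩ := (hc.isCompact.image hζ'.continuous).isBounded.exists_norm_le
    exact integrable_mul_lineDeriv hη hc v hζ'.continuous.aestronglyMeasurable M
      fun y hy => hM _ (mem_image_of_mem _ hy)
  · have := (hη.continuous.integrable_of_hasCompactSupport hc (μ := volume)).smul_of_top_left
      (hζ'.memLp_lineDeriv v)
    exact this.congr (Eventually.of_forall fun y => by simp [mul_comm])
  · rw [hζ'.integral_lineDeriv_mul_eq hη hc v, ← integral_neg]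
    simp_rw [lineDeriv_neg]
    congr 1; ext y; ring

theorem inner_E2 (x y : E2) : ⟪x, y⟫ = x 0 * y 0 + x 1 * y 1 := by
  simp [PiLp.inner_apply, Fin.sum_univ_two, mul_comm]

theorem trace_E2 (A : E2 →L[ℝ] E2) :
    LinearMap.trace ℝ E2 A.toLinearMap =
      A (EuclideanSpace.single 0 1) 0 + A (EuclideanSpace.single 1 1) 1 := by
  rw [LinearMap.trace_eq_sum_inner _ (EuclideanSpace.basisFun (Fin 2) ℝ)]
  simp [Fin.sum_univ_two, inner_E2]

theorem contDiffAt_radial_field {h : ℝ → ℝ} (hh : ContDiffOn ℝ 1 h (Ioi 0)) {P : E2 → E2}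
    (hP : ContDiff ℝ 1 P) {y : E2} (hy : P y ≠ 0) (i : Fin 2) :
    ContDiffAt ℝ 1 (fun y => h ‖P y‖ / ‖P y‖ * P y i) y := by
  have hn : ContDiffAt ℝ 1 (fun y => ‖P y‖) y := hP.contDiffAt.norm ℝ hy
  have h1 : ContDiffAt ℝ 1 (fun y => h ‖P y‖) y :=
    (hh.contDiffAt (Ioi_mem_nhds (norm_pos_iff.2 hy))).comp y hn
  have h2 : ContDiffAt ℝ 1 (fun y => P y i) y := by
    have := hP.contDiffAt (x := y)
    fun_prop
  exact (h1.div hn (norm_ne_zero_iff.2 hy)).mul h2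

theorem lineDeriv_radial_field {h : ℝ → ℝ} (hh : ContDiffOn ℝ 1 h (Ioi 0)) {P : E2 → E2}
    (hP : ContDiff ℝ 1 P) {y : E2} (hy : P y ≠ 0) (i : Fin 2) (v : E2) :
    lineDeriv ℝ (fun y => h ‖P y‖ / ‖P y‖ * P y i) y v =
      (deriv h ‖P y‖ * ‖P y‖ - h ‖P y‖) / ‖P y‖ ^ 3 * ⟪P y, fderiv ℝ P y v⟫ * P y i
        + h ‖P y‖ / ‖P y‖ * fderiv ℝ P y v i := by
  have hpos : 0 < ‖P y‖ := norm_pos_iff.2 hy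
  have hline : HasDerivAt (fun t : ℝ => P (y + t • v)) (fderiv ℝ P y v) 0 :=
    (((hP.differentiable one_ne_zero) y).hasFDerivAt.hasLineDerivAt v)
  have hsq := hline.norm_sq
  have hn : HasDerivAt (fun t : ℝ => ‖P (y + t • v)‖) (⟪P y, fderiv ℝ P y v⟫ / ‖P y‖) 0 := by
    have := hsq.sqrt (by simpa using hy)
    simp only [Real.sqrt_sq (norm_nonneg _), zero_smul, add_zero] at this
    convert this using 1
    field_simp
  have hd : HasDerivAt h (deriv h ‖P y‖) ‖P y‖ :=
    ((hh.contDiffAt (Ioi_mem_nhds hpos)).differentiableAt one_ne_zero).hasDerivAt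
  have h1 : HasDerivAt (fun t : ℝ => h ‖P (y + t • v)‖)
      (deriv h ‖P y‖ * (⟪P y, fderiv ℝ P y v⟫ / ‖P y‖)) 0 := by
    refine HasDerivAt.comp (h₂ := h) (0 : ℝ) ?_ hn
    simpa using hd
  have h2 : HasDerivAt (fun t : ℝ => P (y + t • v) i) (fderiv ℝ P y v i) 0 := by
    exact ((EuclideanSpace.proj i : E2 →L[ℝ] ℝ).hasFDerivAt.comp_hasDerivAt (0 : ℝ) hline)
  have h3 := (h1.div hn (by simpa using hy)).mul h2
  have : HasLineDerivAt ℝ (fun y => h ‖P y‖ / ‖P y‖ * P y i) _ y v := h3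
  rw [this.lineDeriv]
  simp only [Pi.div_apply, zero_smul, add_zero]
  field_simp

/-- Weak formulation of `-div ((h ‖P‖ / ‖P‖) P) ≥ c`. -/
theorem le_integral_radial_field {D : NNReal} {η : E2 → ℝ} {x : E2} {s r c : ℝ}
    (hη : LipschitzWith D η) (hsupp : tsupport η ⊆ closedBall x s) (hsr : s < r)
    (hη0 : ∀ y, 0 ≤ η y)
    {h : ℝ → ℝ} (hh : ContDiffOn ℝ 1 h (Ioi 0)) {P : E2 → E2}
    (hP : ContDiff ℝ 1 P) (hP0 : ∀ y ∈ ball x r, P y ≠ 0)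
    (hdiv : ∀ y ∈ closedBall x s,
      (deriv h ‖P y‖ * ‖P y‖ - h ‖P y‖) / ‖P y‖ ^ 3 * ⟪fderiv ℝ P y (P y), P y⟫
        + h ‖P y‖ / ‖P y‖ * LinearMap.trace ℝ E2 (fderiv ℝ P y).toLinearMap ≤ -c) :
    Integrable (fun y => h ‖P y‖ / ‖P y‖ * P y 0 * lineDeriv ℝ η y (EuclideanSpace.single 0 1)
        + h ‖P y‖ / ‖P y‖ * P y 1 * lineDeriv ℝ η y (EuclideanSpace.single 1 1)) ∧
    c * ∫ y, η y ≤ ∫ y, (h ‖P y‖ / ‖P y‖ * P y 0 * lineDeriv ℝ η y (EuclideanSpace.single 0 1)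
        + h ‖P y‖ / ‖P y‖ * P y 1 * lineDeriv ℝ η y (EuclideanSpace.single 1 1)) := by
  have hζ : ∀ i, ContDiffOn ℝ 1 (fun y => h ‖P y‖ / ‖P y‖ * P y i) (ball x r) := fun i y hy =>
    (contDiffAt_radial_field hh hP (hP0 y hy) i).contDiffWithinAt
  obtain ⟨i0, j0, k0⟩ := integral_mul_lineDeriv_of_contDiffOn hη hsupp hsr (hζ 0)
    (EuclideanSpace.single 0 1)
  obtain ⟨i1, j1, k1⟩ := integral_mul_lineDeriv_of_contDiffOn hη hsupp hsr (hζ 1)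
    (EuclideanSpace.single 1 1)
  have hc : HasCompactSupport η :=
    (isCompact_closedBall x s).of_isClosed_subset (isClosed_tsupport _) hsupp
  have hηi : Integrable η := hη.continuous.integrable_of_hasCompactSupport hc
  refine ⟨i0.add i1, ?_⟩
  rw [integral_add i0 i1, k0, k1, ← neg_add, ← integral_add j0 j1, ← integral_neg,
    ← integral_const_mul]
  refine integral_mono (hηi.const_mul _) (j0.add j1).neg fun y => ?_
  by_cases hy : y ∈ tsupport η
  · have hyx := hsupp hy
    have hy0 := hP0 y (closedBall_subset_ball hsr hyx)
    have hd := hdiv y hyx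
    have hlin : fderiv ℝ P y (P y) = P y 0 • fderiv ℝ P y (EuclideanSpace.single 0 1)
        + P y 1 • fderiv ℝ P y (EuclideanSpace.single 1 1) := by
      rw [← map_smul, ← map_smul, ← map_add]
      congr 1
      ext i; fin_cases i <;> simp
    rw [hlin, trace_E2, inner_add_left, real_inner_smul_left, real_inner_smul_left] at hd
    simp only
    rw [lineDeriv_radial_field hh hP hy0, lineDeriv_radial_field hh hP hy0,
      real_inner_comm, real_inner_comm _ (P y)]
    have := mul_le_mul_of_nonneg_right hd (hη0 y)
    linarith
  · simp [image_eq_zero_of_notMem_tsupport hy]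

/-- Joint convergence of the inverses `H ε` of `k + ε id` to the inverse `h` of `k`. -/
theorem tendsto_inverse_add_mul {k h : ℝ → ℝ} (hk : StrictMonoOn k (Ici 0))
    (hb : BijOn k (Ici 0) (Ici 0)) (hinv : InvOn h k (Ici 0) (Ici 0)) {H : ℝ → ℝ → ℝ}
    (hH : ∀ ε, 0 < ε → InvOn (H ε) (fun ρ => k ρ + ε * ρ) (Ici 0) (Ici 0))
    (hH0 : ∀ ε, 0 < ε → ∀ s, 0 ≤ s → 0 ≤ H ε s) :
    (∀ ε, 0 < ε → ∀ s, 0 ≤ s → H ε s ≤ h s) ∧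
    ∀ s, 0 < s → Tendsto (fun z : ℝ × ℝ => H z.1 z.2) (𝓝[>] 0 ×ˢ 𝓝 s) (𝓝 (h s)) := by
  have hm := (strictMonoOn_of_invOn hk hb hinv).monotoneOn
  have heq : ∀ ε, 0 < ε → ∀ s, 0 ≤ s → H ε s = h (s - ε * H ε s) ∧ 0 ≤ s - ε * H ε s := by
    intro ε hε s hs
    have h1 : k (H ε s) + ε * H ε s = s := (hH ε hε).2 hs
    have h2 : s - ε * H ε s = k (H ε s) := by linarith
    rw [h2, hinv.1 (hH0 ε hε s hs)]
    exact ⟨rfl, hb.mapsTo (hH0 ε hε s hs)⟩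
  have hle : ∀ ε, 0 < ε → ∀ s, 0 ≤ s → H ε s ≤ h s := by
    intro ε hε s hs
    obtain ⟨h1, h2⟩ := heq ε hε s hs
    rw [h1]
    exact hm h2 hs (by have := mul_nonneg hε.le (hH0 ε hε s hs); linarith)
  refine ⟨hle, fun s hs => ?_⟩
  have hε : ∀ᶠ z : ℝ × ℝ in 𝓝[>] 0 ×ˢ 𝓝 s, 0 < z.1 := tendsto_fst.eventually self_mem_nhdsWithin
  have hs1 : ∀ᶠ z : ℝ × ℝ in 𝓝[>] 0 ×ˢ 𝓝 s, 0 < z.2 ∧ z.2 < s + 1 :=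
    tendsto_snd.eventually (Ioo_mem_nhds hs (by linarith))
  have t1 : Tendsto (fun z : ℝ × ℝ => z.1) (𝓝[>] 0 ×ˢ 𝓝 s) (𝓝 0) :=
    tendsto_fst.mono_right nhdsWithin_le_nhds
  have t2 : Tendsto (fun z : ℝ × ℝ => z.1 * H z.1 z.2) (𝓝[>] 0 ×ˢ 𝓝 s) (𝓝 0) := by
    refine squeeze_zero' (g := fun z => z.1 * h (s + 1)) ?_ ?_ (by simpa using t1.mul_const _)
    · filter_upwards [hε, hs1] with z h1 h2 using mul_nonneg h1.le (hH0 _ h1 _ h2.1.le)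
    · filter_upwards [hε, hs1] with z h1 h2
      exact mul_le_mul_of_nonneg_left ((hle _ h1 _ h2.1.le).trans
        (hm h2.1.le (by simp only [mem_Ici]; linarith) h2.2.le)) h1.le
  have t3 : Tendsto (fun z : ℝ × ℝ => z.2 - z.1 * H z.1 z.2) (𝓝[>] 0 ×ˢ 𝓝 s) (𝓝 s) := by
    simpa using tendsto_snd.sub t2
  refine (((continuousAt_of_invOn hk hb hinv hs).tendsto).comp t3).congr' ?_
  filter_upwards [hε, hs1] with z h1 h2 using ((heq _ h1 _ h2.1.le).1).symm

theorem deriv_nonneg_of_strictMonoOn {k : ℝ → ℝ} {k' ρ : ℝ} (hk : StrictMonoOn k (Ici 0))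
    (hρ : 0 < ρ) (hd : HasDerivAt k k' ρ) : 0 ≤ k' := by
  rw [← hd.hasDerivWithinAt.derivWithin (uniqueDiffOn_Ici 0 ρ hρ.le)]
  exact hk.monotoneOn.derivWithin_nonneg

/-- Strict negativity of the degenerate operator at a point yields a uniform bound on the
divergence of the regularised fields nearby. -/
theorem eventually_div_le {k k' h : ℝ → ℝ} (hk : StrictMonoOn k (Ici 0))
    (hb : BijOn k (Ici 0) (Ici 0)) (hinv : InvOn h k (Ici 0) (Ici 0))
    (hc : ContinuousOn k (Ici 0)) (hk0 : k 0 = 0)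
    (hd : ∀ ρ, 0 < ρ → HasDerivAt k (k' ρ) ρ) (hc' : ContinuousOn k' (Ioi 0))
    {H : ℝ → ℝ → ℝ}
    (hH : ∀ ε, 0 < ε → InvOn (H ε) (fun ρ => k ρ + ε * ρ) (Ici 0) (Ici 0))
    {P : E2 → E2} (hP : ContDiff ℝ 1 P) {x : E2} (hx : P x ≠ 0)
    (hneg : h ‖P x‖ * k' (h ‖P x‖) * ‖P x‖ ^ 2 *
        LinearMap.trace ℝ E2 (fderiv ℝ P x).toLinearMap
        + (‖P x‖ - h ‖P x‖ * k' (h ‖P x‖)) * ⟪fderiv ℝ P x (P x), P x⟫ < 0) :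
    ∃ c > 0, ∀ᶠ z : ℝ × E2 in 𝓝[>] 0 ×ˢ 𝓝 x, P z.2 ≠ 0 ∧
      (deriv (H z.1) ‖P z.2‖ * ‖P z.2‖ - H z.1 ‖P z.2‖) / ‖P z.2‖ ^ 3 *
          ⟪fderiv ℝ P z.2 (P z.2), P z.2⟫
        + H z.1 ‖P z.2‖ / ‖P z.2‖ * LinearMap.trace ℝ E2 (fderiv ℝ P z.2).toLinearMap ≤ -c := by
  have hreg := fun ε hε => bijOn_add_mul hk hb hc hk0 (ε := ε) hε
  have hs0 : 0 < ‖P x‖ := norm_pos_iff.2 hx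
  set ρ₀ := h ‖P x‖ with hρ₀
  have hρpos : 0 < ρ₀ := pos_of_invOn hk hb hinv hs0
  have hPc : Continuous P := hP.continuous
  have hAc : Continuous (fderiv ℝ P) := hP.continuous_fderiv one_ne_zero
  have htend := (tendsto_inverse_add_mul hk hb hinv hH
    (fun ε hε s hs => nonneg_of_invOn (hreg ε hε).2 (hH ε hε) hs)).2 _ hs0
  have t1 : Tendsto (fun z : ℝ × E2 => z.1) (𝓝[>] 0 ×ˢ 𝓝 x) (𝓝 0) :=
    tendsto_fst.mono_right nhdsWithin_le_nhds
  have t2 : Tendsto (fun z : ℝ × E2 => P z.2) (𝓝[>] 0 ×ˢ 𝓝 x) (𝓝 (P x)) :=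
    (hPc.tendsto x).comp tendsto_snd
  have t2n := t2.norm
  have t3 : Tendsto (fun z : ℝ × E2 => H z.1 ‖P z.2‖) (𝓝[>] 0 ×ˢ 𝓝 x) (𝓝 ρ₀) :=
    htend.comp (tendsto_fst.prodMk t2n)
  have t4 : Tendsto (fun z : ℝ × E2 => k' (H z.1 ‖P z.2‖)) (𝓝[>] 0 ×ˢ 𝓝 x) (𝓝 (k' ρ₀)) :=
    ((hc'.continuousAt (Ioi_mem_nhds hρpos)).tendsto).comp t3
  have t5 : Tendsto (fun z : ℝ × E2 => k' (H z.1 ‖P z.2‖) + z.1) (𝓝[>] 0 ×ˢ 𝓝 x) (𝓝 (k' ρ₀)) := by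
    simpa using t4.add t1
  have tAP : Tendsto (fun z : ℝ × E2 => fderiv ℝ P z.2 (P z.2)) (𝓝[>] 0 ×ˢ 𝓝 x)
      (𝓝 (fderiv ℝ P x (P x))) := ((hAc.clm_apply hPc).tendsto x).comp tendsto_snd
  have ttr : Tendsto (fun z : ℝ × E2 => LinearMap.trace ℝ E2 (fderiv ℝ P z.2).toLinearMap)
      (𝓝[>] 0 ×ˢ 𝓝 x) (𝓝 (LinearMap.trace ℝ E2 (fderiv ℝ P x).toLinearMap)) := by
    have : Continuous fun A : E2 →L[ℝ] E2 => LinearMap.trace ℝ E2 A.toLinearMap := by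
      simp_rw [trace_E2]
      fun_prop
    exact ((this.comp hAc).tendsto x).comp tendsto_snd
  have tQ := ((t3.mul t5).mul (t2n.pow 2)).mul ttr |>.add
    ((t2n.sub (t3.mul t5)).mul (tAP.inner t2))
  set Q := ρ₀ * k' ρ₀ * ‖P x‖ ^ 2 * LinearMap.trace ℝ E2 (fderiv ℝ P x).toLinearMap
        + (‖P x‖ - ρ₀ * k' ρ₀) * ⟪fderiv ℝ P x (P x), P x⟫ with hQ
  have hk'0 : 0 ≤ k' ρ₀ := deriv_nonneg_of_strictMonoOn hk hρpos (hd _ hρpos)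
  set M := (k' ρ₀ + 1) * (‖P x‖ + 1) ^ 3 with hM
  have hMpos : 0 < M := by positivity
  refine ⟨-(Q / 2) / M, div_pos (by linarith) hMpos, ?_⟩
  filter_upwards [tQ.eventually_lt_const (show Q < Q / 2 by linarith),
    t2n.eventually (lt_mem_nhds hs0), t2n.eventually_lt_const (lt_add_one _),
    t5.eventually_lt_const (lt_add_one _), t3.eventually (lt_mem_nhds hρpos),
    tendsto_fst.eventually (self_mem_nhdsWithin (a := (0 : ℝ)) (s := Ioi 0))]
    with z hz1 hz2 hz3 hz4 hz5 hz6
  have hz6 : 0 < z.1 := hz6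
  refine ⟨norm_pos_iff.1 hz2, ?_⟩
  have hkz := deriv_nonneg_of_strictMonoOn hk hz5 (hd _ hz5)
  set κ := k' (H z.1 ‖P z.2‖) + z.1 with hκ
  have hκpos : 0 < κ := by linarith
  have hder : deriv (H z.1) ‖P z.2‖ = κ⁻¹ := by
    refine (hasDerivAt_of_invOn (hreg _ hz6).1 (hreg _ hz6).2 (hH _ hz6) hz2 ?_
      hκpos.ne').deriv
    have := (hd _ hz5).add ((hasDerivAt_id (H z.1 ‖P z.2‖)).const_mul z.1)
    rw [mul_one] at this
    exact this
  rw [hder]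
  have hden : κ * ‖P z.2‖ ^ 3 ≤ M := by
    rw [hM]; gcongr
  have hden0 : 0 < κ * ‖P z.2‖ ^ 3 := by positivity
  generalize ⟪fderiv ℝ P z.2 (P z.2), P z.2⟫ = I at *
  generalize LinearMap.trace ℝ E2 (fderiv ℝ P z.2).toLinearMap = T at *
  generalize H z.1 ‖P z.2‖ = ρ at *
  have e : (κ⁻¹ * ‖P z.2‖ - ρ) / ‖P z.2‖ ^ 3 * I + ρ / ‖P z.2‖ * T
      = (ρ * κ * ‖P z.2‖ ^ 2 * T + (‖P z.2‖ - ρ * κ) * I) / (κ * ‖P z.2‖ ^ 3) := by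
    field_simp
    ring
  rw [e, div_le_iff₀ hden0, neg_div, neg_neg]
  have : (Q / 2) / M * M ≤ (Q / 2) / M * (κ * ‖P z.2‖ ^ 3) :=
    mul_le_mul_of_nonpos_left hden (div_nonpos_of_nonpos_of_nonneg (by linarith) hMpos.le)
  rw [div_mul_cancel₀ _ hMpos.ne'] at this
  linarith

/-- Gluing a function that is Lipschitz on a ball with zero. -/
theorem exists_lipschitzWith_of_ball {m : E2 → ℝ} {x : E2} {s r M : ℝ} {K : NNReal} (hsr : s < r)
    (hm : LipschitzOnWith K m (ball x r)) (h0 : ∀ y ∉ closedBall x s, m y = 0)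
    (hM : ∀ y, |m y| ≤ M) : ∃ D, LipschitzWith D m := by
  have hM0 : 0 ≤ M := (abs_nonneg _).trans (hM x)
  have key : ∀ y z, z ∉ ball x r → dist (m y) (m z) ≤ M / (r - s) * dist y z := by
    intro y z hz
    have hrs : 0 < r - s := by linarith
    rw [h0 z fun h => hz (closedBall_subset_ball hsr h)]
    by_cases hy : y ∈ closedBall x s
    · rw [Real.dist_eq, sub_zero, div_mul_eq_mul_div, le_div_iff₀ hrs]
      refine mul_le_mul (hM y) ?_ hrs.le hM0
      rw [mem_closedBall] at hy
      rw [mem_ball, not_lt] at hz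
      have := dist_triangle z y x
      rw [dist_comm z y] at this
      linarith
    · rw [h0 y hy, dist_self]; positivity
  refine ⟨max K (M / (r - s)).toNNReal, LipschitzWith.of_dist_le_mul fun y z => ?_⟩
  have hrs : 0 ≤ M / (r - s) := div_nonneg hM0 (by linarith)
  have hc1 : (K : ℝ) ≤ (max K (M / (r - s)).toNNReal : NNReal) := by simp
  have hc2 : M / (r - s) ≤ (max K (M / (r - s)).toNNReal : NNReal) := by simp [hrs]
  by_cases hz : z ∈ ball x r
  · by_cases hy : y ∈ ball x r
    · exact (hm.dist_le_mul y hy z hz).trans (mul_le_mul_of_nonneg_right hc1 dist_nonneg)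
    · rw [dist_comm, dist_comm y]
      exact (key z y hy).trans (mul_le_mul_of_nonneg_right hc2 dist_nonneg)
  · exact (key y z hz).trans (mul_le_mul_of_nonneg_right hc2 dist_nonneg)

theorem lineDeriv_single_eq_gradient {w : E2 → ℝ} {y : E2} (hw : DifferentiableAt ℝ w y)
    (i : Fin 2) : lineDeriv ℝ w y (EuclideanSpace.single i 1) = gradient w y i := by
  rw [hw.lineDeriv_eq_fderiv, ← inner_gradient_left, EuclideanSpace.inner_single_right]
  simp

/-- A compactly supported Lipschitz bump built from a strict touching from above. -/
theorem exists_touching_bump {V Φ : E2 → ℝ} {C : NNReal} (hV : LipschitzWith C V)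
    (hΦ : ContDiff ℝ 1 Φ) {x : E2} {s r δ : ℝ} (hs : 0 < s) (hsr : s < r) (hδ : 0 < δ)
    (hmax : ∀ y ∈ ball x r, V y - Φ y + δ * dist y x ^ 2 ≤ V x - Φ x) :
    ∃ (η : E2 → ℝ) (D : NNReal), LipschitzWith D η ∧ tsupport η ⊆ closedBall x s ∧
      (∀ y, 0 ≤ η y) ∧ 0 < η x ∧
      ∀ y, 0 < η y → ∃ a, η =ᶠ[𝓝 y] fun z => V z - Φ z + a := by
  obtain ⟨K, hK⟩ := hΦ.contDiffOn.exists_lipschitzOnWith (s := closedBall x r) one_ne_zero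
    (convex_closedBall x r) (isCompact_closedBall x r)
  let a := δ * s ^ 2 - (V x - Φ x)
  let m : E2 → ℝ := fun y => max (V y - Φ y + a) 0
  let η : E2 → ℝ := (ball x r).indicator m
  have hin : ∀ y ∈ ball x r, η y = m y := fun y hy => indicator_of_mem hy _
  have hout : ∀ y ∉ closedBall x s, η y = 0 := by
    intro y hy
    by_cases hyr : y ∈ ball x r
    · rw [hin y hyr]
      refine max_eq_right ?_
      have h1 := hmax y hyr
      rw [mem_closedBall, not_le] at hy
      have h2 : δ * s ^ 2 ≤ δ * dist y x ^ 2 := by gcongr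
      simp only [a]; linarith
    · exact indicator_of_notMem hyr _
  have hnn : ∀ y, 0 ≤ η y := fun y => indicator_nonneg (fun _ _ => le_max_right _ _) _
  have hle : ∀ y, |η y| ≤ δ * s ^ 2 := by
    intro y
    rw [abs_of_nonneg (hnn y)]
    by_cases hyr : y ∈ ball x r
    · rw [hin y hyr]
      refine max_le ?_ (by positivity)
      have h1 := hmax y hyr
      have h2 : 0 ≤ δ * dist y x ^ 2 := by positivity
      simp only [a]; linarith
    · rw [show η y = 0 from indicator_of_notMem hyr _]; positivity
  have hlip : LipschitzOnWith (C + K + 0) η (ball x r) := by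
    have h1 : LipschitzOnWith (C + K + 0) (fun y => V y - Φ y + a) (ball x r) :=
      (hV.lipschitzOnWith.sub (hK.mono ball_subset_closedBall)).add
        (LipschitzWith.const a).lipschitzOnWith
    intro y hy z hz
    rw [hin y hy, hin z hz]
    have h2 : LipschitzWith 1 (fun t : ℝ => max t 0) := LipschitzWith.id.max_const 0
    have := (h2.comp_lipschitzOnWith h1) hy hz
    rwa [one_mul] at this
  obtain ⟨D, hD⟩ := exists_lipschitzWith_of_ball hsr hlip hout hle
  refine ⟨η, D, hD, closure_minimal (fun y hy => ?_) isClosed_closedBall, hnn, ?_, ?_⟩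
  · by_contra h; exact hy (hout y h)
  · rw [hin x (mem_ball_self (hs.trans hsr))]
    refine lt_max_of_lt_left ?_
    simp only [a]
    have : 0 < δ * s ^ 2 := by positivity
    linarith
  · intro y hy
    have hyr : y ∈ ball x r := by
      by_contra h
      rw [show η y = 0 from indicator_of_notMem h _] at hy
      exact lt_irrefl _ hy
    refine ⟨a, ?_⟩
    have hcont : ContinuousAt η y := hD.continuous.continuousAt
    filter_upwards [isOpen_ball.mem_nhds hyr, hcont.eventually (lt_mem_nhds hy)] with z hz1 hz2
    rw [hin z hz1] at hz2 ⊢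
    rcases lt_max_iff.1 hz2 with h | h
    · exact max_eq_left h.le
    · exact absurd h (lt_irrefl _)

theorem touching_inequality_of_strict {k k' h : ℝ → ℝ} (hk : StrictMonoOn k (Ici 0))
    (hb : BijOn k (Ici 0) (Ici 0)) (hinv : InvOn h k (Ici 0) (Ici 0))
    (hc : ContinuousOn k (Ici 0)) (hk0 : k 0 = 0)
    (hd : ∀ ρ, 0 < ρ → HasDerivAt k (k' ρ) ρ) (hc' : ContinuousOn k' (Ioi 0))
    {Ω : Set E2} (hΩ : IsOpen Ω) {U V : E2 → ℝ} {CU CV : NNReal} (hU : LipschitzWith CU U)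
    (hV : LipschitzWith CV V)
    (hUV : ∀ᵐ y : E2, y ∈ Ω → h ‖gradient V y‖ / ‖gradient V y‖ * gradient V y 0 = -gradient U y 1 ∧
      h ‖gradient V y‖ / ‖gradient V y‖ * gradient V y 1 = gradient U y 0)
    {x : E2} (hxΩ : x ∈ Ω) {Φ : E2 → ℝ} (hΦ : ContDiff ℝ 2 Φ) {δ : ℝ} (hδ : 0 < δ)
    (hmax : ∀ᶠ y in 𝓝 x, V y - Φ y + δ * dist y x ^ 2 ≤ V x - Φ x)
    {P : E2 → E2} (hP : P = gradient Φ) (hx : P x ≠ 0) :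
    0 ≤ h ‖P x‖ * k' (h ‖P x‖) * ‖P x‖ ^ 2 *
        LinearMap.trace ℝ E2 (fderiv ℝ P x).toLinearMap
        + (‖P x‖ - h ‖P x‖ * k' (h ‖P x‖)) * ⟪fderiv ℝ P x (P x), P x⟫ := by
  by_contra! hneg
  have hPc : ContDiff ℝ 1 P := by
    rw [hP]
    exact (InnerProductSpace.toDual ℝ E2).symm.contDiff.comp
      (hΦ.fderiv_right (m := 1) (by norm_num))
  have hreg := fun ε hε => bijOn_add_mul hk hb hc hk0 (ε := ε) hε
  let H : ℝ → ℝ → ℝ := fun ε => Function.invFunOn (fun ρ => k ρ + ε * ρ) (Ici 0)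
  have hH : ∀ ε, 0 < ε → InvOn (H ε) (fun ρ => k ρ + ε * ρ) (Ici 0) (Ici 0) :=
    fun ε hε => (hreg ε hε).2.invOn_invFunOn
  have hH0 : ∀ ε, 0 < ε → ∀ s, 0 ≤ s → 0 ≤ H ε s :=
    fun ε hε s hs => nonneg_of_invOn (hreg ε hε).2 (hH ε hε) hs
  have hHc : ∀ ε, 0 < ε → ContDiffOn ℝ 1 (H ε) (Ioi 0) := by
    intro ε hε
    refine contDiffOn_of_invOn (k' := fun ρ => k' ρ + ε) (hreg ε hε).1 (hreg ε hε).2 (hH ε hε) ?_ ?_ ?_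
    · intro ρ hρ
      have := (hd ρ hρ).add ((hasDerivAt_id ρ).const_mul ε)
      rw [mul_one] at this
      exact this
    · exact hc'.add continuousOn_const
    · intro ρ hρ
      have := deriv_nonneg_of_strictMonoOn hk hρ (hd ρ hρ)
      positivity
  obtain ⟨hHle, hHt⟩ := tendsto_inverse_add_mul hk hb hinv hH hH0
  have hm := (strictMonoOn_of_invOn hk hb hinv).monotoneOn
  have hh0 : ∀ s, 0 ≤ s → 0 ≤ h s := fun s hs => nonneg_of_invOn hb hinv hs
  obtain ⟨c, hcpos, hev⟩ := eventually_div_le hk hb hinv hc hk0 hd hc' hH hPc hx hneg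
  obtain ⟨pa, hpa, pb, hpb, hab⟩ := eventually_prod_iff.1 hev
  obtain ⟨r, hr, hball⟩ := Metric.eventually_nhds_iff_ball.1
    ((hpb.and hmax).and (hΩ.eventually_mem hxΩ))
  obtain ⟨ε₀, hε₀⟩ := hpa.exists
  obtain ⟨η, D, hη, hsupp, hη0, hηx, hηloc⟩ := exists_touching_bump hV (hΦ.of_le one_le_two)
    (half_pos hr) (half_lt_self hr) hδ fun y hy => (hball y hy).1.2
  have hcs : HasCompactSupport η :=
    (isCompact_closedBall x _).of_isClosed_subset (isClosed_tsupport _) hsupp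
  have hsub : tsupport η ⊆ ball x r := hsupp.trans (closedBall_subset_ball (half_lt_self hr))
  have hP0 : ∀ y ∈ ball x r, P y ≠ 0 := fun y hy => (hab hε₀ (hball y hy).1.1).1
  let R : (ℝ → ℝ) → E2 → ℝ := fun g y =>
    g ‖P y‖ / ‖P y‖ * P y 0 * lineDeriv ℝ η y (EuclideanSpace.single 0 1)
        + g ‖P y‖ / ‖P y‖ * P y 1 * lineDeriv ℝ η y (EuclideanSpace.single 1 1)
  have hRε : ∀ᶠ ε in 𝓝[>] (0 : ℝ), Integrable (R (H ε)) ∧ c * ∫ y, η y ≤ ∫ y, R (H ε) y := by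
    filter_upwards [hpa, self_mem_nhdsWithin] with ε hε hε0
    exact le_integral_radial_field hη hsupp (half_lt_self hr) hη0 (hHc ε hε0) hPc hP0
      fun y hy => (hab hε (hball y (closedBall_subset_ball (half_lt_self hr) hy)).1.1).2
  obtain ⟨M, hM⟩ := (hcs.isCompact.image hPc.continuous).isBounded.exists_norm_le
  have hM' : ∀ y ∈ tsupport η, ‖P y‖ ≤ M := fun y hy => hM _ (mem_image_of_mem _ hy)
  have hbound : ∀ ε, 0 < ε → ∀ y, ‖R (H ε) y‖ ≤
      (tsupport η).indicator (fun _ => h M * D + h M * D) y := by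
    intro ε hε y
    by_cases hy : y ∈ tsupport η
    · rw [indicator_of_mem hy]
      have hpos : 0 < ‖P y‖ := norm_pos_iff.2 (hP0 y (hsub hy))
      have hterm : ∀ i : Fin 2, ‖H ε ‖P y‖ / ‖P y‖ * P y i *
          lineDeriv ℝ η y (EuclideanSpace.single i 1)‖ ≤ h M * D := by
        intro i
        rw [norm_mul]
        refine mul_le_mul ?_ ?_ (norm_nonneg _) (hh0 _ (hpos.le.trans (hM' y hy)))
        · rw [norm_mul, norm_div, norm_norm, Real.norm_of_nonneg (hH0 ε hε _ hpos.le)]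
          calc H ε ‖P y‖ / ‖P y‖ * ‖P y i‖ ≤ H ε ‖P y‖ / ‖P y‖ * ‖P y‖ := by
                refine mul_le_mul_of_nonneg_left (PiLp.norm_apply_le _ _) ?_
                exact div_nonneg (hH0 ε hε _ hpos.le) hpos.le
            _ = H ε ‖P y‖ := div_mul_cancel₀ _ hpos.ne'
            _ ≤ h ‖P y‖ := hHle ε hε _ hpos.le
            _ ≤ h M := hm hpos.le (hpos.le.trans (hM' y hy)) (hM' y hy)
        · simpa using norm_lineDeriv_le_of_lipschitz ℝ hη (x₀ := y)
            (v := EuclideanSpace.single i (1 : ℝ))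
      exact (norm_add_le _ _).trans (add_le_add (hterm 0) (hterm 1))
    · rw [indicator_of_notMem hy]
      simp [R, lineDeriv_eq_zero_of_notMem_tsupport hy]
  have hbi : Integrable ((tsupport η).indicator (fun _ => h M * D + h M * D)) := by
    rw [integrable_indicator_iff hcs.isCompact.measurableSet]
    exact integrableOn_const hcs.isCompact.measure_lt_top.ne
  have hlimpt : ∀ y, Tendsto (fun ε => R (H ε) y) (𝓝[>] 0) (𝓝 (R h y)) := by
    intro y
    by_cases hy : y ∈ tsupport η
    · have hpos : 0 < ‖P y‖ := norm_pos_iff.2 (hP0 y (hsub hy))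
      have ht : Tendsto (fun ε => H ε ‖P y‖) (𝓝[>] 0) (𝓝 (h ‖P y‖)) :=
        (hHt _ hpos).comp (tendsto_id.prodMk tendsto_const_nhds)
      exact (((ht.div_const _).mul_const _).mul_const _).add
        (((ht.div_const _).mul_const _).mul_const _)
    · simp [R, lineDeriv_eq_zero_of_notMem_tsupport hy]
  have hRm : AEStronglyMeasurable (R h) := by
    obtain ⟨u, hu⟩ := exists_seq_tendsto (𝓝[>] (0 : ℝ))
    obtain ⟨N, hN⟩ := eventually_atTop.1 (hu.eventually hRε)
    refine aestronglyMeasurable_of_tendsto_ae atTop (f := fun n => R (H (u (n + N))))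
      (fun n => (hN _ (Nat.le_add_left _ _)).1.aestronglyMeasurable) ?_
    exact Eventually.of_forall fun y =>
      (hlimpt y).comp (hu.comp (tendsto_add_atTop_nat N))
  have hRi : Integrable (R h) := by
    refine hbi.mono' hRm (Eventually.of_forall fun y => ?_)
    refine le_of_tendsto (hlimpt y).norm ?_
    filter_upwards [self_mem_nhdsWithin] with ε hε using hbound ε hε y
  have hlim : Tendsto (fun ε => ∫ y, R (H ε) y) (𝓝[>] 0) (𝓝 (∫ y, R h y)) := by
    refine tendsto_integral_filter_of_dominated_convergence _ ?_ ?_ hbi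
      (Eventually.of_forall hlimpt)
    · filter_upwards [hRε] with ε hε using hε.1.aestronglyMeasurable
    · filter_upwards [self_mem_nhdsWithin] with ε hε using Eventually.of_forall (hbound ε hε)
  have hlower : c * ∫ y, η y ≤ ∫ y, R h y :=
    ge_of_tendsto hlim (hRε.mono fun ε hε => hε.2)
  have hηpos : 0 < ∫ y, η y :=
    hη.continuous.integral_pos_of_hasCompactSupport_nonneg_nonzero hcs hη0 hηx.ne'
  have hUint : ∀ v w : E2, Integrable fun y => lineDeriv ℝ U y v * lineDeriv ℝ η y w := fun v w =>
    integrable_mul_lineDeriv hη hcs w (aestronglyMeasurable_lineDeriv hU.continuous _) (CU * ‖v‖)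
      fun y _ => norm_lineDeriv_le_of_lipschitz ℝ hU
  let e : Fin 2 → E2 := fun i => EuclideanSpace.single i 1
  have hle : ∫ y, R h y ≤ ∫ y, (lineDeriv ℝ U y (e 0) * lineDeriv ℝ η y (e 1)
      - lineDeriv ℝ U y (e 1) * lineDeriv ℝ η y (e 0)) := by
    refine integral_mono_ae hRi ((hUint _ _).sub (hUint _ _)) ?_
    filter_upwards [hUV, hU.ae_differentiableAt, hV.ae_differentiableAt, hη.ae_differentiableAt]
      with y hy hyU hyV hyη
    rcases (hη0 y).eq_or_lt' with h0 | hpos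
    · have hmin : IsLocalMin η y := Eventually.of_forall fun z => by rw [h0]; exact hη0 z
      have hz : ∀ v, lineDeriv ℝ η y v = 0 := fun v => by
        rw [hyη.lineDeriv_eq_fderiv, hmin.fderiv_eq_zero]; rfl
      simp [R, hz]
    · have hyΩ : y ∈ Ω := (hball y (hsub (subset_tsupport _ hpos.ne'))).2
      obtain ⟨a, ha⟩ := hηloc y hpos
      have hgη : ∀ i, lineDeriv ℝ η y (e i) = gradient V y i - P y i := by
        intro i
        have hyΦ : DifferentiableAt ℝ Φ y := (hΦ.differentiable two_ne_zero) y
        rw [ha.lineDeriv_eq, hP, ← lineDeriv_single_eq_gradient hyV,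
          ← lineDeriv_single_eq_gradient hyΦ, hyV.lineDeriv_eq_fderiv, hyΦ.lineDeriv_eq_fderiv,
          (show DifferentiableAt ℝ (fun z => V z - Φ z + a) y from
            (hyV.sub hyΦ).add_const a).lineDeriv_eq_fderiv]
        rw [fderiv_add_const, fderiv_fun_sub hyV hyΦ]
        rfl
      have hmono := monotone_radial_field hm hh0 (gradient V y) (P y)
      rw [inner_E2] at hmono
      simp only [PiLp.sub_apply, PiLp.smul_apply, smul_eq_mul] at hmono
      rw [(hy hyΩ).1, (hy hyΩ).2] at hmono
      simp only [R]
      change _ * lineDeriv ℝ η y (e 0) + _ * lineDeriv ℝ η y (e 1) ≤ _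
      rw [hgη, hgη, lineDeriv_single_eq_gradient hyU, lineDeriv_single_eq_gradient hyU]
      linarith
  rw [integral_sub (hUint _ _) (hUint _ _), integral_lineDeriv_mul_lineDeriv_comm hU hη hcs,
    sub_self] at hle
  have := mul_pos hcpos hηpos
  linarith

theorem touching_inequality {k k' h : ℝ → ℝ} (hk : StrictMonoOn k (Ici 0))
    (hb : BijOn k (Ici 0) (Ici 0)) (hinv : InvOn h k (Ici 0) (Ici 0))
    (hc : ContinuousOn k (Ici 0)) (hk0 : k 0 = 0)
    (hd : ∀ ρ, 0 < ρ → HasDerivAt k (k' ρ) ρ) (hc' : ContinuousOn k' (Ioi 0))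
    {Ω : Set E2} (hΩ : IsOpen Ω) {U V : E2 → ℝ} {CU CV : NNReal} (hU : LipschitzWith CU U)
    (hV : LipschitzWith CV V)
    (hUV : ∀ᵐ y : E2, y ∈ Ω → h ‖gradient V y‖ / ‖gradient V y‖ * gradient V y 0 = -gradient U y 1 ∧
      h ‖gradient V y‖ / ‖gradient V y‖ * gradient V y 1 = gradient U y 0)
    {x : E2} (hxΩ : x ∈ Ω) {φ : E2 → ℝ} (hφ : ContDiff ℝ 2 φ)
    (hmax : IsLocalMax (fun y => V y - φ y) x) {p : E2} (hp : gradient φ x = p) (hp0 : p ≠ 0) :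
    0 ≤ h ‖p‖ * k' (h ‖p‖) * ‖p‖ ^ 2 *
        LinearMap.trace ℝ E2 (fderiv ℝ (gradient φ) x).toLinearMap
        + (‖p‖ - h ‖p‖ * k' (h ‖p‖)) * ⟪fderiv ℝ (gradient φ) x p, p⟫ := by
  set ρ := h ‖p‖
  set B := ρ * k' ρ * ‖p‖ ^ 2 * 2 + (‖p‖ - ρ * k' ρ) * ‖p‖ ^ 2
  have hgφ : ContDiff ℝ 1 (gradient φ) :=
    (InnerProductSpace.toDual ℝ E2).symm.contDiff.comp (hφ.fderiv_right (m := 1) (by norm_num))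
  suffices hδ : ∀ δ : ℝ, 0 < δ → 0 ≤ ρ * k' ρ * ‖p‖ ^ 2 *
        LinearMap.trace ℝ E2 (fderiv ℝ (gradient φ) x).toLinearMap
        + (‖p‖ - ρ * k' ρ) * ⟪fderiv ℝ (gradient φ) x p, p⟫ + 2 * δ * B by
    have ht : Tendsto (fun δ : ℝ => ρ * k' ρ * ‖p‖ ^ 2 *
        LinearMap.trace ℝ E2 (fderiv ℝ (gradient φ) x).toLinearMap
        + (‖p‖ - ρ * k' ρ) * ⟪fderiv ℝ (gradient φ) x p, p⟫ + 2 * δ * B) (𝓝[>] 0)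
        (𝓝 (ρ * k' ρ * ‖p‖ ^ 2 *
        LinearMap.trace ℝ E2 (fderiv ℝ (gradient φ) x).toLinearMap
        + (‖p‖ - ρ * k' ρ) * ⟪fderiv ℝ (gradient φ) x p, p⟫ + 2 * 0 * B)) :=
      (Continuous.tendsto (by fun_prop) (0 : ℝ)).mono_left nhdsWithin_le_nhds
    have := ge_of_tendsto ht (b := 0) (by
      filter_upwards [self_mem_nhdsWithin] with δ hδ0 using hδ δ hδ0)
    simpa using this
  intro δ hδ
  let Φ : E2 → ℝ := fun y => φ y + δ * ‖y - x‖ ^ 2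
  have hΦ : ContDiff ℝ 2 Φ :=
    hφ.add (contDiff_const.mul ((contDiff_id.sub contDiff_const).norm_sq ℝ))
  have hgrad : gradient Φ = fun y => gradient φ y + (2 * δ) • (y - x) := by
    refine gradient_eq fun y => ?_
    have h1 := ((hφ.differentiable two_ne_zero) y).hasGradientAt.hasFDerivAt
    have h2 := ((((hasFDerivAt_id y).sub_const x).norm_sq).const_mul δ)
    rw [hasGradientAt_iff_hasFDerivAt]
    refine (h1.add h2).congr_fderiv ?_
    ext v
    simp only [_root_.add_apply, InnerProductSpace.toDual_apply_apply,
      inner_add_left, real_inner_smul_left]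
    simp [inner_sub_left]
    ring
  have hPx : gradient Φ x = p := by rw [hgrad, ← hp]; simp
  have hdP : fderiv ℝ (gradient Φ) x
      = fderiv ℝ (gradient φ) x + (2 * δ) • ContinuousLinearMap.id ℝ E2 := by
    rw [hgrad]
    exact (((hgφ.differentiable one_ne_zero) x).hasFDerivAt.add
      (((hasFDerivAt_id x).sub_const x).const_smul (2 * δ))).fderiv
  have := touching_inequality_of_strict hk hb hinv hc hk0 hd hc' hΩ hU hV hUV hxΩ hΦ hδ
    (hmax.mono fun y hy => by simp only [Φ, dist_eq_norm, sub_self, norm_zero]; linarith)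
    rfl (by rw [hPx]; exact hp0)
  rw [hPx, hdP] at this
  rw [trace_E2] at this ⊢
  simp only [_root_.add_apply, _root_.smul_apply,
    ContinuousLinearMap.id_apply, inner_add_left, real_inner_smul_left, PiLp.add_apply,
    PiLp.smul_apply, smul_eq_mul, real_inner_self_eq_norm_sq,
    PiLp.single_apply, if_true] at this
  simp only [B]
  change 0 ≤ ρ * k' ρ * ‖p‖ ^ 2 * _ + (‖p‖ - ρ * k' ρ) * _ at this
  linarith

/-- Inversion of the pointwise relation between the gradients of a function and of its stream
function. -/
theorem radial_field_of_stream {k h : ℝ → ℝ} (hk : StrictMonoOn k (Ici 0)) (hk0 : k 0 = 0)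
    (hinv : InvOn h k (Ici 0) (Ici 0)) {p q : E2}
    (hp0 : p 0 = if q = 0 then 0 else -(k ‖q‖ * q 1 / ‖q‖))
    (hp1 : p 1 = if q = 0 then 0 else k ‖q‖ * q 0 / ‖q‖) :
    h ‖p‖ / ‖p‖ * p 0 = -q 1 ∧ h ‖p‖ / ‖p‖ * p 1 = q 0 := by
  by_cases hq : q = 0
  · simp [hp0, hp1, hq]
  · rw [if_neg hq] at hp0 hp1
    have hqpos : 0 < ‖q‖ := norm_pos_iff.2 hq
    have hkpos : 0 < k ‖q‖ := hk0 ▸ hk (mem_Ici.2 le_rfl) hqpos.le hqpos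
    have hq2 : ‖q‖ ^ 2 = q 0 * q 0 + q 1 * q 1 := by
      rw [← real_inner_self_eq_norm_sq, inner_E2]
    have hn : ‖p‖ = k ‖q‖ := by
      refine (pow_left_inj₀ (norm_nonneg _) hkpos.le two_ne_zero).1 ?_
      rw [← real_inner_self_eq_norm_sq, inner_E2, hp0, hp1]
      field_simp
      rw [hq2]; ring
    rw [hn, hinv.1 hqpos.le, hp0, hp1]
    constructor <;> field_simp

theorem gradient_fun_neg (w : E2 → ℝ) (y : E2) :
    gradient (fun z => -w z) y = -gradient w y := by
  simp [gradient, fderiv_fun_neg]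

/-- The zero-mean stream function `vₐ` of the minimizer `uₐ` is a viscosity
solution of `−[1 − αₐ(g'ₐ(‖∇v‖))]·Δ∞v − ‖∇v‖²·αₐ(g'ₐ(‖∇v‖))·Δv = 0`, where `g'ₐ` is the
inverse of `f'ₐ` and `αₐ(ρ) = ρ f''ₐ(ρ)/f'ₐ(ρ)` (extended at `0` by its positive limit). -/
theorem stream_function_is_viscositySolution
    (Ω : Set E2) (hΩo : IsOpen Ω) (hΩb : Bornology.IsBounded Ω)
    (hsc : SimplyConnectedSpace ↥Ω)
    (ψ : E2 → ℝ) (hψ : ContinuousOn ψ (frontier Ω))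
    (fa : ℝ → ℝ)
    (hconv : StrictConvexOn ℝ (Set.Ici 0) fa)
    (hC1 : ContDiffOn ℝ 1 fa (Set.Ici 0))
    (hC2 : ContDiffOn ℝ 2 fa (Set.Ioi 0))
    (h0 : dtop fa 0 = 0)
    (hmono : StrictMonoOn (dtop fa) (Set.Ici 0))
    (hbij : Set.BijOn (dtop fa) (Set.Ici 0) (Set.Ici 0))
    (gpa : ℝ → ℝ) (hinv : Set.InvOn gpa (dtop fa) (Set.Ici 0) (Set.Ici 0))
    (ℓ : ℝ) (hℓ : 0 < ℓ)
    (hlim : Tendsto (fun ρ => ρ * deriv (dtop fa) ρ / dtop fa ρ)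
      (nhdsWithin 0 (Set.Ioi 0)) (nhds ℓ))
    (α : ℝ → ℝ)
    (hα : ∀ ρ : ℝ, α ρ = if ρ = 0 then ℓ else ρ * deriv (dtop fa) ρ / dtop fa ρ)
    (ua : E2 → ℝ) (hua : SolvesP fa Ω ψ ua)
    (va : E2 → ℝ) (hva : IsStreamFn (dtop fa) Ω ua va) :
    ViscositySol Ω
      (fun p H => -(1 - α (gpa ‖p‖)) * ⟪H p, p⟫
        - ‖p‖ ^ 2 * α (gpa ‖p‖) * LinearMap.trace ℝ E2 H.toLinearMap) va := by
  have hcont : ContinuousOn (dtop fa) (Ici 0) :=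
    hC1.continuousOn_derivWithin (uniqueDiffOn_Ici 0) le_rfl
  have hdC : ContDiffOn ℝ 1 (dtop fa) (Ioi 0) := by
    rw [show (2 : WithTop ℕ∞) = 1 + 1 by norm_num,
      contDiffOn_succ_iff_deriv_of_isOpen isOpen_Ioi] at hC2
    exact hC2.2.2.congr fun ρ hρ => derivWithin_of_mem_nhds (Ici_mem_nhds hρ)
  have hd : ∀ ρ, 0 < ρ → HasDerivAt (dtop fa) (deriv (dtop fa) ρ) ρ := fun ρ hρ =>
    ((hdC.contDiffAt (Ioi_mem_nhds hρ)).differentiableAt one_ne_zero).hasDerivAt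
  have hdc : ContinuousOn (deriv (dtop fa)) (Ioi 0) :=
    hdC.continuousOn_deriv_of_isOpen isOpen_Ioi le_rfl
  obtain ⟨⟨LU, hLU⟩, -, -⟩ := hua
  obtain ⟨⟨LV, hLV⟩, -, hrel⟩ := hva
  obtain ⟨U, hU, hUeq⟩ := hLU.extend_real
  obtain ⟨V, hV, hVeq⟩ := hLV.extend_real
  have hgrad : ∀ {w W : E2 → ℝ}, EqOn w W Ω → ∀ y ∈ Ω, gradient w y = gradient W y := by
    intro w W h y hy
    rw [gradient, gradient, (h.eventuallyEq_of_mem (hΩo.mem_nhds hy)).fderiv_eq]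
  have hUV : ∀ᵐ y : E2, y ∈ Ω →
      gpa ‖gradient V y‖ / ‖gradient V y‖ * gradient V y 0 = -gradient U y 1 ∧
      gpa ‖gradient V y‖ / ‖gradient V y‖ * gradient V y 1 = gradient U y 0 := by
    filter_upwards [(ae_restrict_iff' hΩo.measurableSet).1 hrel] with y hy hyΩ
    have := hy hyΩ
    rw [hgrad hVeq y hyΩ, hgrad (hUeq.mono subset_closure) y hyΩ] at this
    exact radial_field_of_stream hmono h0 hinv this.1 this.2
  have hUV' : ∀ᵐ y : E2, y ∈ Ω →
      gpa ‖gradient (fun z => -V z) y‖ / ‖gradient (fun z => -V z) y‖ *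
        gradient (fun z => -V z) y 0 = -gradient (fun z => -U z) y 1 ∧
      gpa ‖gradient (fun z => -V z) y‖ / ‖gradient (fun z => -V z) y‖ *
        gradient (fun z => -V z) y 1 = gradient (fun z => -U z) y 0 := by
    filter_upwards [hUV] with y hy hyΩ
    simp only [gradient_fun_neg, norm_neg, PiLp.neg_apply, mul_neg, (hy hyΩ).1, (hy hyΩ).2]
    exact ⟨trivial, trivial⟩
  have hFeq : ∀ (p : E2) (A : E2 →L[ℝ] E2), p ≠ 0 →
      -(1 - α (gpa ‖p‖)) * ⟪A p, p⟫ - ‖p‖ ^ 2 * α (gpa ‖p‖) * LinearMap.trace ℝ E2 A.toLinearMap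
        = -(gpa ‖p‖ * deriv (dtop fa) (gpa ‖p‖) * ‖p‖ ^ 2 * LinearMap.trace ℝ E2 A.toLinearMap
          + (‖p‖ - gpa ‖p‖ * deriv (dtop fa) (gpa ‖p‖)) * ⟪A p, p⟫) / ‖p‖ := by
    intro p A hp
    have hpos : 0 < ‖p‖ := norm_pos_iff.2 hp
    rw [hα, if_neg (pos_of_invOn hmono hbij hinv hpos).ne', hinv.2 hpos.le]
    field_simp
    ring
  refine ⟨hLV.continuousOn, fun x hx φ hφ hmax => ?_, fun x hx φ hφ hmin => ?_⟩
  · by_cases hp : gradient φ x = 0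
    · simp [hp]
    have hmax' : IsLocalMax (fun y => V y - φ y) x := by
      refine (hmax.isLocalMax (hΩo.mem_nhds hx)).congr ?_
      filter_upwards [hΩo.mem_nhds hx] with y hy
      rw [hVeq hy]
    have := touching_inequality hmono hbij hinv hcont h0 hd hdc hΩo hU hV hUV hx hφ hmax' rfl hp
    simp only
    rw [hFeq _ _ hp]
    exact div_nonpos_of_nonpos_of_nonneg (neg_nonpos.2 this) (norm_nonneg _)
  · by_cases hp : gradient φ x = 0
    · simp [hp]
    have hmin' : IsLocalMax (fun y => -V y - -φ y) x := by
      refine (hmin.isLocalMin (hΩo.mem_nhds hx)).neg.congr ?_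
      filter_upwards [hΩo.mem_nhds hx] with y hy
      rw [hVeq hy]; ring
    have hgn : gradient (fun z => -φ z) = -gradient φ := funext (gradient_fun_neg φ)
    have := touching_inequality hmono hbij hinv hcont h0 hd hdc hΩo hU.neg hV.neg hUV' hx hφ.neg
      hmin' (gradient_fun_neg φ x) (neg_ne_zero.2 hp)
    rw [hgn, fderiv_neg, norm_neg] at this
    simp only
    rw [hFeq _ _ hp]
    refine div_nonneg ?_ (norm_nonneg _)
    rw [trace_E2] at this ⊢
    simp only [_root_.neg_apply, map_neg, inner_neg_right, neg_neg,
      PiLp.neg_apply] at this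
    linarith
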